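/- Deterministic self-consistent root near the semicircle: Let P₀(z,x) = 1 + zx + x² + Σ_{k=2}^{m} a_k q^{−2(k−1)} x^{2k} be a polynomial with real bounded coefficients a_k and q ≥ N^β with β > 0 fixed. Then there exists an algebraic function m₀: ℂ₊ → ℂ₊ with P₀(z, m₀(z)) = 0 such that m₀ is the Stieltjes transform of a symmetric probability measure ϱ₀ supported on [−L₀, L₀] with L₀ = 2 + O(1/q²). -/

import Mathlib

open MeasureTheory

/-- The Stieltjes transform `m(z) = ∫ (x − z)⁻¹ dμ(x)` of a measure `μ` on `ℝ`. -/
noncomputable def stieltjesTransform (μ : Measure ℝ) (z : ℂ) : ℂ :=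
  ∫ x, ((x : ℂ) - z)⁻¹ ∂μ

/-- The deterministic self-consistent polynomial
`P₀(z,x) = 1 + zx + x² + Σ_{k=2}^{m} a_k q^{−2(k−1)} x^{2k}`. -/
noncomputable def P₀ (q : ℝ) (a : ℕ → ℝ) (m : ℕ) (z x : ℂ) : ℂ :=
  1 + z * x + x ^ 2 + ∑ k ∈ Finset.Icc 2 m, ((a k : ℂ) / (q : ℂ) ^ (2 * (k - 1))) * x ^ (2 * k)

open Complex Metric Real in
/-- Averaging `Im Φ` against a kernel that is odd under conjugation on the unit circle amounts to
averaging `Φ` itself, provided `Φ` commutes with conjugation. -/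
theorem circleAverage_im_mul_of_odd {Φ k : ℂ → ℂ} (hΦ : ContinuousOn Φ (sphere 0 1))
    (hk : ContinuousOn k (sphere 0 1))
    (hconj : ∀ u ∈ sphere (0 : ℂ) 1, Φ u⁻¹ = (starRingEnd ℂ) (Φ u))
    (hodd : ∀ u ∈ sphere (0 : ℂ) 1, k u⁻¹ = -k u) :
    circleAverage (fun u => ((Φ u).im : ℂ) * k u) 0 1
      = -I * circleAverage (fun u => Φ u * k u) 0 1 := by
  have hΦk : CircleIntegrable (fun u => Φ u * k u) 0 1 :=
    (hΦ.mul hk).circleIntegrable zero_le_one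
  have hinv : Set.MapsTo (fun u : ℂ => u⁻¹) (sphere 0 1) (sphere 0 1) := fun u hu => by
    simpa using hu
  have hcinv : ContinuousOn (fun u : ℂ => u⁻¹) (sphere 0 1) :=
    continuousOn_inv₀.mono fun u hu => by
      rintro rfl
      simp at hu
  have hΦk_inv : CircleIntegrable (fun u => Φ u⁻¹ * k u⁻¹) 0 1 :=
    ((hΦ.comp hcinv hinv).mul (hk.comp hcinv hinv)).circleIntegrable zero_le_one
  have h1 : circleAverage (fun u => ((Φ u).im : ℂ) * k u) 0 1
      = circleAverage (fun u => (-I / 2) • (Φ u * k u + Φ u⁻¹ * k u⁻¹)) 0 1 := by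
    refine circleAverage_congr_sphere fun u hu => ?_
    rw [abs_one] at hu
    simp only [hodd u hu, hconj u hu, smul_eq_mul, im_eq_sub_conj]
    field_simp
    ring_nf
    simp only [I_sq]
    ring
  rw [h1, circleAverage_fun_smul, circleAverage_fun_add hΦk hΦk_inv,
    circleAverage_zero_one_congr_inv (f := fun u => Φ u * k u), smul_eq_mul]
  ring

open Real Set in
/-- The image under `θ ↦ -2 lam cos θ` of the measure on the circle with density
`Im Φ(e^{iθ}) · 2 lam sin θ / 2π`. -/
noncomputable def arcMeasure (lam : ℝ) (Φ : ℂ → ℂ) : Measure ℝ :=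
  ((volume.restrict (Ioc 0 (2 * π))).withDensity fun θ =>
    ENNReal.ofReal ((2 * π)⁻¹ * ((Φ (circleMap 0 1 θ)).im * (2 * lam * Real.sin θ)))).map
      fun θ => -(2 * lam * Real.cos θ)

open Complex Metric Real in
theorem integral_arcMeasure {lam : ℝ} {Φ : ℂ → ℂ} (hlam : 0 ≤ lam)
    (hΦ : ContinuousOn Φ (sphere 0 1)) (hpos : ∀ u ∈ sphere (0 : ℂ) 1, 0 ≤ (Φ u).im * u.im)
    {f : ℝ → ℂ} (hf : Measurable f) :
    ∫ x, f x ∂(arcMeasure lam Φ) = circleAverage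
      (fun u => ((Φ u).im : ℂ) * (2 * lam * u.im * f (-(2 * lam * u.re)))) 0 1 := by
  have hcont : Continuous fun θ : ℝ => Φ (circleMap 0 1 θ) :=
    hΦ.comp_continuous (continuous_circleMap 0 1) fun θ => circleMap_mem_sphere 0 zero_le_one θ
  have him : ∀ θ, (circleMap 0 1 θ).im = Real.sin θ := fun θ => by
    simp [circleMap, exp_ofReal_mul_I_im]
  have hre : ∀ θ, (circleMap 0 1 θ).re = Real.cos θ := fun θ => by
    simp [circleMap, exp_ofReal_mul_I_re]
  have hmeas : Measurable fun θ =>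
      ENNReal.ofReal ((2 * π)⁻¹ * ((Φ (circleMap 0 1 θ)).im * (2 * lam * Real.sin θ))) := by
    have : Continuous fun θ => (Φ (circleMap 0 1 θ)).im := continuous_im.comp hcont
    exact (by fun_prop : Continuous fun θ =>
      ((2 * π)⁻¹ * ((Φ (circleMap 0 1 θ)).im * (2 * lam * Real.sin θ)))).measurable.ennreal_ofReal
  rw [arcMeasure, integral_map (by fun_prop) hf.aestronglyMeasurable,
    integral_withDensity_eq_integral_toReal_smul hmeas (by simp), circleAverage_def,
    intervalIntegral.integral_of_le (by positivity), ← integral_smul]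
  refine integral_congr_ae (.of_forall fun θ => ?_)
  have h0 : 0 ≤ (2 * π)⁻¹ * ((Φ (circleMap 0 1 θ)).im * (2 * lam * Real.sin θ)) := by
    have := hpos _ (circleMap_mem_sphere 0 zero_le_one θ)
    rw [him] at this
    have h2 : (Φ (circleMap 0 1 θ)).im * (2 * lam * Real.sin θ)
        = 2 * lam * ((Φ (circleMap 0 1 θ)).im * Real.sin θ) := by ring
    rw [h2]
    positivity
  simp only [ENNReal.toReal_ofReal h0, him, hre, real_smul]
  push_cast
  ring

theorem arcMeasure_compl_Icc {lam : ℝ} (hlam : 0 ≤ lam) (Φ : ℂ → ℂ) :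
    arcMeasure lam Φ (Set.Icc (-(2 * lam)) (2 * lam))ᶜ = 0 := by
  rw [arcMeasure, Measure.map_apply (by fun_prop) measurableSet_Icc.compl]
  suffices h : (fun θ => -(2 * lam * Real.cos θ)) ⁻¹' (Set.Icc (-(2 * lam)) (2 * lam))ᶜ = ∅ by
    rw [h, measure_empty]
  ext θ
  simp only [Set.mem_preimage, Set.mem_compl_iff, Set.mem_Icc, Set.mem_empty_iff_false, iff_false,
    not_not]
  have h1 := mul_nonneg hlam (sub_nonneg.2 (Real.cos_le_one θ))
  have h2 := mul_nonneg hlam (sub_nonneg.2 (Real.neg_one_le_cos θ))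
  constructor <;> nlinarith

open Complex Metric Real in
/-- The arc measure of `u ↦ u * g u` has total mass `lam * g 0`. -/
theorem isProbabilityMeasure_arcMeasure {lam : ℝ} {g : ℂ → ℂ} (hlam : 0 ≤ lam)
    (hg : DiffContOnCl ℂ g (ball 0 1))
    (hconj : ∀ u ∈ sphere (0 : ℂ) 1, g u⁻¹ = (starRingEnd ℂ) (g u))
    (hpos : ∀ u ∈ sphere (0 : ℂ) 1, 0 ≤ (u * g u).im * u.im) (hmass : lam * g 0 = 1) :
    IsProbabilityMeasure (arcMeasure lam fun u => u * g u) := by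
  have hgc : ContinuousOn g (sphere 0 1) := hg.continuousOn_ball.mono sphere_subset_closedBall
  have hΦ : ContinuousOn (fun u => u * g u) (sphere 0 1) := continuousOn_id.mul hgc
  have hinv : ∀ u ∈ sphere (0 : ℂ) 1, u⁻¹ = (starRingEnd ℂ) u := fun u hu =>
    inv_eq_conj (by simpa using hu)
  have hint_arc := integral_arcMeasure hlam hΦ hpos (f := fun _ => 1) measurable_const
  simp only [mul_one] at hint_arc
  rw [circleAverage_im_mul_of_odd hΦ (by fun_prop)
    (fun u hu => by rw [hconj u hu, hinv u hu, map_mul])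
    (fun u hu => by rw [hinv u hu]; simp)] at hint_arc
  have h1 : circleAverage (fun u => u * g u * (2 * lam * u.im)) 0 1
      = circleAverage (fun u => (-I * lam) • (u ^ 2 * g u - g u)) 0 1 := by
    refine circleAverage_congr_sphere fun u hu => ?_
    rw [abs_one] at hu
    have hu0 : u ≠ 0 := by
      rintro rfl
      simp at hu
    simp only [im_eq_sub_conj, ← hinv u hu, smul_eq_mul]
    field_simp
    ring_nf
    simp only [I_sq]
    ring
  have h2 : DiffContOnCl ℂ (fun u => u ^ 2 * g u) (ball 0 1) := by
    have : DiffContOnCl ℂ (fun u : ℂ => u ^ 2) (ball 0 1) :=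
      (differentiable_pow 2).diffContOnCl
    simpa using this.smul hg
  have e1 : circleAverage (fun u => u ^ 2 * g u) 0 1 = 0 := by
    have := DiffContOnCl.circleAverage (R := 1) (c := 0) (by simpa using h2)
    simpa using this
  have e2 : circleAverage g 0 1 = g 0 :=
    DiffContOnCl.circleAverage (R := 1) (c := 0) (by simpa using hg)
  rw [h1, circleAverage_fun_smul, circleAverage_fun_sub
    (ContinuousOn.circleIntegrable zero_le_one (by fun_prop))
    (hgc.circleIntegrable zero_le_one), e1, e2, integral_const] at hint_arc
  have h3 : ((arcMeasure lam fun u => u * g u).real Set.univ : ℂ) = 1 := by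
    have h4 : -I * ((-I * ↑lam) • (0 - g 0)) = 1 := by
      rw [← hmass, smul_eq_mul]
      linear_combination (-lam * g 0) * I_sq
    rw [h4] at hint_arc
    simpa using hint_arc
  refine ⟨?_⟩
  have h5 : (arcMeasure lam fun u => u * g u).real Set.univ = 1 := by exact_mod_cast h3
  simpa [Measure.real, ENNReal.toReal_eq_one_iff] using h5

open Complex Metric Real in
/-- The Stieltjes transform of the arc measure at `-lam * (w + 1 / w)` is `w * g w`. -/
theorem stieltjesTransform_arcMeasure {lam : ℝ} {g : ℂ → ℂ} (hlam : 0 < lam)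
    (hg : DiffContOnCl ℂ g (ball 0 1))
    (hconj : ∀ u ∈ sphere (0 : ℂ) 1, g u⁻¹ = (starRingEnd ℂ) (g u))
    (hpos : ∀ u ∈ sphere (0 : ℂ) 1, 0 ≤ (u * g u).im * u.im)
    {w : ℂ} (hw : ‖w‖ < 1) (hw0 : w ≠ 0) :
    stieltjesTransform (arcMeasure lam fun u => u * g u) (-lam * (w + w⁻¹)) = w * g w := by
  have hgc : ContinuousOn g (sphere 0 1) := hg.continuousOn_ball.mono sphere_subset_closedBall
  have hΦ : ContinuousOn (fun u => u * g u) (sphere 0 1) := continuousOn_id.mul hgc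
  have hinv : ∀ u ∈ sphere (0 : ℂ) 1, u⁻¹ = (starRingEnd ℂ) u := fun u hu =>
    inv_eq_conj (by simpa using hu)
  have hne : ∀ u ∈ sphere (0 : ℂ) 1, u ≠ 0 := fun u hu => by
    rintro rfl
    simp at hu
  have hsub : ∀ u ∈ sphere (0 : ℂ) 1, u - w ≠ 0 := fun u hu h => by
    rw [sub_eq_zero.1 h] at hu
    simp at hu
    linarith
  have hone : ∀ u ∈ closedBall (0 : ℂ) 1, 1 - w * u ≠ 0 := fun u hu h => by
    have h1 : ‖w * u‖ = 1 := by rw [← sub_eq_zero.1 h]; simp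
    rw [norm_mul] at h1
    have : ‖u‖ ≤ 1 := by simpa using hu
    nlinarith [norm_nonneg w, norm_nonneg u]
  have hint_arc := integral_arcMeasure (lam := lam) hlam.le hΦ hpos
    (f := fun x => ((x : ℂ) - (-lam * (w + w⁻¹)))⁻¹) (by fun_prop)
  have hlamC : (lam : ℂ) ≠ 0 := by exact_mod_cast hlam.ne'
  set k : ℂ → ℂ := fun u => I * (u / (u - w) - (1 - w * u)⁻¹) with hk
  have hkc : ContinuousOn k (sphere 0 1) := by
    refine continuousOn_const.mul (.sub (.div continuousOn_id (by fun_prop) hsub)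
      (.inv₀ (by fun_prop) fun u hu => hone u (sphere_subset_closedBall hu)))
  have hkodd : ∀ u ∈ sphere (0 : ℂ) 1, k u⁻¹ = -k u := fun u hu => by
    have h1 := hsub u hu
    have h2 := hone u (sphere_subset_closedBall hu)
    have h3 := hne u hu
    have h4 : u⁻¹ - w = (1 - w * u) / u := by field_simp
    have h5 : 1 - w * u⁻¹ = (u - w) / u := by field_simp
    simp only [hk, h4, h5]
    field_simp
    ring
  have h1 : circleAverage (fun u : ℂ => (((u * g u).im : ℝ) : ℂ) * (2 * lam * u.im *
      (((-(2 * lam * u.re) : ℝ) : ℂ) - (-lam * (w + w⁻¹)))⁻¹)) 0 1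
      = circleAverage (fun u => (((u * g u).im : ℝ) : ℂ) * k u) 0 1 := by
    refine circleAverage_congr_sphere fun u hu => ?_
    rw [abs_one] at hu
    have h1 := hsub u hu
    have h2 := hone u (sphere_subset_closedBall hu)
    have h3 := hne u hu
    have h4 : ((-(2 * lam * u.re) : ℝ) : ℂ) - (-lam * (w + w⁻¹))
        = lam * (u - w) * (1 - w * u) / (u * w) := by
      push_cast
      rw [re_eq_add_conj, ← hinv u hu]
      field_simp
      ring
    simp only [hk, h4, im_eq_sub_conj u, ← hinv u hu]
    congr 1
    rw [mul_comm w u] at h2 ⊢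
    field_simp
    ring_nf
    simp only [I_sq]
    ring
  rw [stieltjesTransform, hint_arc, h1, circleAverage_im_mul_of_odd hΦ hkc
    (fun u hu => by rw [hconj u hu, hinv u hu, map_mul]) hkodd]
  have hD : DiffContOnCl ℂ (fun u => u * g u) (ball 0 1) := by
    simpa using (differentiable_id.diffContOnCl (s := ball (0 : ℂ) 1)).smul hg
  have hD2 : DiffContOnCl ℂ (fun u => (1 - w * u)⁻¹ * (u * g u)) (ball 0 1) := by
    have h2 : DiffContOnCl ℂ (fun u : ℂ => (1 - w * u)⁻¹) (ball 0 1) := by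
      refine DiffContOnCl.inv (Differentiable.diffContOnCl (by fun_prop)) fun u hu => ?_
      rw [closure_ball _ one_ne_zero] at hu
      exact hone u hu
    simpa using h2.smul hD
  have e1 : circleAverage (fun u => u / (u - w) * (u * g u)) 0 1 = w * g w := by
    have := DiffContOnCl.circleAverage_smul_div (R := 1) (c := 0) (w := w) (by simpa using hD)
      (by simpa using hw)
    simpa using this
  have e2 : circleAverage (fun u => (1 - w * u)⁻¹ * (u * g u)) 0 1 = 0 := by
    have := DiffContOnCl.circleAverage (R := 1) (c := 0) (by simpa using hD2)
    simpa using this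
  have h5 : (fun u => u * g u * k u) = fun u => I • (u / (u - w) * (u * g u)
      - (1 - w * u)⁻¹ * (u * g u)) := by
    funext u
    simp only [hk, smul_eq_mul]
    ring
  rw [h5, circleAverage_fun_smul, circleAverage_fun_sub, e1, e2, smul_eq_mul]
  · linear_combination (-w * g w) * I_sq
  · exact ((ContinuousOn.div continuousOn_id (by fun_prop) hsub).mul hΦ).circleIntegrable
      zero_le_one
  · exact ((ContinuousOn.inv₀ (by fun_prop) fun u hu =>
      hone u (sphere_subset_closedBall hu)).mul hΦ).circleIntegrable zero_le_one

section UniformizedEquation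

variable {A : Type*} [NormedCommRing A] [NormedAlgebra ℝ A]

/-- The self-consistent equation in a uniformizing coordinate `V`, as a map of the coefficients,
the edge parameter and the unknown element. -/
def uniformizedEquation (V : A) (m : ℕ) (p : (Finset.Icc 2 m → ℝ) × (ℝ × A)) : A :=
  V * p.2.2 ^ 2 + 1 + ∑ k, p.1 k • (V ^ (k : ℕ) * p.2.2 ^ (2 * (k : ℕ)))
    - p.2.1 • ((V + 1) * p.2.2)

theorem contDiff_uniformizedEquation (V : A) (m : ℕ) :
    ContDiff ℝ 1 (uniformizedEquation V m) := by
  unfold uniformizedEquation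
  fun_prop

theorem fderiv_uniformizedEquation_inr (V : A) (m : ℕ) (x : ℝ × A) :
    fderiv ℝ (uniformizedEquation V m) (0, (1, 1)) (0, x)
      = (V - 1) * x.2 - x.1 • (V + 1) := by
  have h1 : HasLineDerivAt ℝ (uniformizedEquation V m)
      (fderiv ℝ (uniformizedEquation V m) (0, (1, 1)) (0, x)) (0, (1, 1)) (0, x) :=
    ((contDiff_uniformizedEquation V m).differentiable one_ne_zero _).hasFDerivAt.hasLineDerivAt _
  have h2 : (fun t : ℝ => uniformizedEquation V m ((0, (1, 1)) + t • (0, x))) = fun t : ℝ =>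
      t • ((V - 1) * x.2 - x.1 • (V + 1)) +
        t ^ 2 • (V * x.2 ^ 2 - x.1 • ((V + 1) * x.2)) := by
    funext t
    simp only [uniformizedEquation, Prod.smul_mk, Prod.fst_add, Prod.snd_add, smul_zero, add_zero,
      Pi.zero_apply, zero_smul, Finset.sum_const_zero, Prod.smul_fst, Prod.smul_snd]
    simp only [smul_eq_mul, Algebra.smul_def, map_add, map_mul, map_pow, map_one]
    ring
  have h3 : HasDerivAt (fun t : ℝ => t • ((V - 1) * x.2 - x.1 • (V + 1)) +
        t ^ 2 • (V * x.2 ^ 2 - x.1 • ((V + 1) * x.2)))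
      ((V - 1) * x.2 - x.1 • (V + 1)) 0 := by
    have := ((hasDerivAt_id (0 : ℝ)).smul_const ((V - 1) * x.2 - x.1 • (V + 1))).add
      (((hasDerivAt_id (0 : ℝ)).pow 2).smul_const (V * x.2 ^ 2 - x.1 • ((V + 1) * x.2)))
    exact this.congr_deriv (by simp)
  rw [HasLineDerivAt, h2] at h1
  exact h1.unique h3

open Filter Topology in
/-- Solvability of the equation for small coefficients, with Lipschitz dependence. -/
theorem exists_uniformizedEquation_eq_zero [CompleteSpace A] (V : A) (m : ℕ)
    (hinj : ∀ (μ : ℝ) (ψ : A), (V - 1) * ψ - μ • (V + 1) = 0 → μ = 0 ∧ ψ = 0)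
    (hsurj : ∀ f, ∃ (μ : ℝ) (ψ : A), (V - 1) * ψ - μ • (V + 1) = f) :
    ∃ C : ℝ, ∀ᶠ ε : Finset.Icc 2 m → ℝ in 𝓝 0,
      ∃ (lam : ℝ) (Ψ : A), uniformizedEquation V m (ε, (lam, Ψ)) = 0 ∧
        |lam - 1| ≤ C * ‖ε‖ ∧ ‖Ψ - 1‖ ≤ C * ‖ε‖ := by
  have hd : HasStrictFDerivAt (uniformizedEquation V m)
      (fderiv ℝ (uniformizedEquation V m) (0, (1, 1))) (0, (1, 1)) :=
    (contDiff_uniformizedEquation V m).contDiffAt.hasStrictFDerivAt one_ne_zero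
  have hinv : (fderiv ℝ (uniformizedEquation V m) (0, (1, 1)) ∘L
      .inr ℝ (Finset.Icc 2 m → ℝ) (ℝ × A)).IsInvertible := by
    set L := fderiv ℝ (uniformizedEquation V m) (0, (1, 1)) ∘L
      .inr ℝ (Finset.Icc 2 m → ℝ) (ℝ × A)
    have hL : ∀ x, L x = (V - 1) * x.2 - x.1 • (V + 1) := fderiv_uniformizedEquation_inr V m
    have hker : L.ker = ⊥ := by
      refine LinearMap.ker_eq_bot'.2 fun x hx => ?_
      obtain ⟨h1, h2⟩ := hinj x.1 x.2 ((hL x).symm.trans hx)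
      exact Prod.ext h1 h2
    have hrange : L.range = ⊤ := by
      refine LinearMap.range_eq_top.2 fun f => ?_
      obtain ⟨μ, ψ, h⟩ := hsurj f
      exact ⟨(μ, ψ), (hL _).trans h⟩
    exact ⟨.ofBijective L hker hrange, ContinuousLinearEquiv.coe_ofBijective _ _ _⟩
  have h0 : uniformizedEquation V m (0, (1, 1)) = 0 := by
    simp [uniformizedEquation]
  have hψ := hd.hasStrictFDerivAt_implicitFunctionOfProdDomain hinv
  have heq := hd.eventually_apply_implicitFunctionOfProdDomain hinv
  have hval : hd.implicitFunctionOfProdDomain hinv 0 = (1, 1) :=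
    (hd.eventually_apply_eq_iff_implicitFunctionOfProdDomain hinv).self_of_nhds.mp rfl
  obtain ⟨C, hC⟩ := hψ.hasFDerivAt.isBigO_sub.bound
  refine ⟨C, ?_⟩
  filter_upwards [heq, hC] with ε h1 h2
  rw [hval, sub_zero] at h2
  refine ⟨_, _, h1.trans h0, ?_, ?_⟩
  · exact (norm_fst_le (hd.implicitFunctionOfProdDomain hinv ε - (1, 1))).trans h2
  · exact (norm_snd_le (hd.implicitFunctionOfProdDomain hinv ε - (1, 1))).trans h2

end UniformizedEquation

section RealHolomorphicDisc

open Metric BoundedContinuousFunction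

/-- The real Banach algebra of bounded holomorphic functions on the disc of radius `4` that commute
with complex conjugation. -/
def realHolomorphicDisc : Subalgebra ℝ (ball (0 : ℂ) 4 →ᵇ ℂ) where
  carrier := {f | ∃ F : ℂ → ℂ, DifferentiableOn ℂ F (ball 0 4) ∧
    (∀ v, F ((starRingEnd ℂ) v) = (starRingEnd ℂ) (F v)) ∧ ∀ v : ball (0 : ℂ) 4, F v = f v}
  mul_mem' := by
    rintro f g ⟨F, hF, hF', hFf⟩ ⟨G, hG, hG', hGg⟩
    exact ⟨F * G, hF.mul hG, fun v => by simp [hF', hG'], fun v => by simp [hFf, hGg]⟩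
  add_mem' := by
    rintro f g ⟨F, hF, hF', hFf⟩ ⟨G, hG, hG', hGg⟩
    exact ⟨F + G, hF.add hG, fun v => by simp [hF', hG'], fun v => by simp [hFf, hGg]⟩
  algebraMap_mem' r := ⟨fun _ => r, differentiableOn_const _, fun v => by simp, fun v => rfl⟩

namespace realHolomorphicDisc

/-- The extension by zero of an element of the algebra. -/
noncomputable def ext (f : realHolomorphicDisc) : ℂ → ℂ :=
  Function.extend Subtype.val f.1 0

theorem ext_apply (f : realHolomorphicDisc) {v : ℂ} (hv : v ∈ ball (0 : ℂ) 4) :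
    ext f v = f.1 ⟨v, hv⟩ :=
  Subtype.val_injective.extend_apply f.1 0 ⟨v, hv⟩

theorem differentiableOn_ext (f : realHolomorphicDisc) :
    DifferentiableOn ℂ (ext f) (ball 0 4) := by
  obtain ⟨F, hF, -, hFf⟩ := f.2
  exact hF.congr fun v hv => by rw [ext_apply f hv, ← hFf]

theorem ext_conj (f : realHolomorphicDisc) (v : ℂ) :
    ext f ((starRingEnd ℂ) v) = (starRingEnd ℂ) (ext f v) := by
  obtain ⟨F, -, hF', hFf⟩ := f.2
  by_cases hv : v ∈ ball (0 : ℂ) 4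
  · have hv' : (starRingEnd ℂ) v ∈ ball (0 : ℂ) 4 := by simpa using hv
    rw [ext_apply f hv, ext_apply f hv', ← hFf, ← hFf, hF']
  · have hv' : (starRingEnd ℂ) v ∉ ball (0 : ℂ) 4 := by simpa using hv
    rw [ext, Function.extend_apply' _ _ _ (fun ⟨a, ha⟩ => hv' (ha ▸ a.2)),
      Function.extend_apply' _ _ _ (fun ⟨a, ha⟩ => hv (ha ▸ a.2))]
    simp

theorem norm_ext_le (f : realHolomorphicDisc) {v : ℂ} (hv : v ∈ ball (0 : ℂ) 4) :
    ‖ext f v‖ ≤ ‖f‖ := by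
  rw [ext_apply f hv]
  exact f.1.norm_coe_le_norm _

theorem eq_of_ext {f g : realHolomorphicDisc} (h : ∀ v ∈ ball (0 : ℂ) 4, ext f v = ext g v) :
    f = g := by
  refine Subtype.ext (BoundedContinuousFunction.ext fun v => ?_)
  rw [← ext_apply f v.2, ← ext_apply g v.2, h v v.2]

theorem ext_add (f g : realHolomorphicDisc) {v : ℂ} (hv : v ∈ ball (0 : ℂ) 4) :
    ext (f + g) v = ext f v + ext g v := by
  simp [ext_apply _ hv]

theorem ext_sub (f g : realHolomorphicDisc) {v : ℂ} (hv : v ∈ ball (0 : ℂ) 4) :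
    ext (f - g) v = ext f v - ext g v := by
  simp [ext_apply _ hv]

theorem ext_mul (f g : realHolomorphicDisc) {v : ℂ} (hv : v ∈ ball (0 : ℂ) 4) :
    ext (f * g) v = ext f v * ext g v := by
  simp [ext_apply _ hv]

theorem ext_pow (f : realHolomorphicDisc) (n : ℕ) {v : ℂ} (hv : v ∈ ball (0 : ℂ) 4) :
    ext (f ^ n) v = ext f v ^ n := by
  simp [ext_apply _ hv]

theorem ext_smul (r : ℝ) (f : realHolomorphicDisc) {v : ℂ} (hv : v ∈ ball (0 : ℂ) 4) :
    ext (r • f) v = r * ext f v := by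
  simp [ext_apply _ hv]

theorem ext_one {v : ℂ} (hv : v ∈ ball (0 : ℂ) 4) : ext 1 v = 1 := by
  simp [ext_apply _ hv]

theorem ext_zero {v : ℂ} (hv : v ∈ ball (0 : ℂ) 4) : ext 0 v = 0 := by
  simp [ext_apply _ hv]

theorem ext_sum {ι : Type*} (s : Finset ι) (f : ι → realHolomorphicDisc) {v : ℂ}
    (hv : v ∈ ball (0 : ℂ) 4) : ext (∑ i ∈ s, f i) v = ∑ i ∈ s, ext (f i) v := by
  simp [ext_apply _ hv]

/-- A bounded holomorphic function commuting with conjugation, as an element of the algebra. -/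
theorem exists_ext_eq {F : ℂ → ℂ} (hF : DifferentiableOn ℂ F (ball 0 4))
    (hF' : ∀ v, F ((starRingEnd ℂ) v) = (starRingEnd ℂ) (F v)) {C : ℝ}
    (hC : ∀ v ∈ ball (0 : ℂ) 4, ‖F v‖ ≤ C) :
    ∃ f : realHolomorphicDisc, ∀ v ∈ ball (0 : ℂ) 4, ext f v = F v :=
  ⟨⟨.ofNormedAddCommGroup (fun v : ball (0 : ℂ) 4 => F v) hF.continuousOn.domRestrict C
    fun v => hC v v.2, F, hF, hF', fun _ => rfl⟩, fun _ hv => ext_apply _ hv⟩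

theorem isClosed : IsClosed (realHolomorphicDisc : Set (ball (0 : ℂ) 4 →ᵇ ℂ)) := by
  refine IsSeqClosed.isClosed fun f g hf hg => ?_
  let e : ℕ → realHolomorphicDisc := fun n => ⟨f n, hf n⟩
  have hpt : ∀ v : ball (0 : ℂ) 4, Filter.Tendsto (fun n => f n v) .atTop (nhds (g v)) := fun v =>
    ((continuous_eval_const (x := v)).tendsto g).comp hg
  refine ⟨Function.extend Subtype.val g 0, ?_, fun v => ?_, fun v =>
    Subtype.val_injective.extend_apply g 0 v⟩
  · have hunif : TendstoUniformlyOn (fun n => ext (e n)) (Function.extend Subtype.val g 0)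
        .atTop (ball 0 4) := by
      rw [Metric.tendstoUniformlyOn_iff]
      intro ε hε
      filter_upwards [(Metric.tendsto_nhds.1 hg) ε hε] with n hn v hv
      rw [ext_apply _ hv, Subtype.val_injective.extend_apply g 0 ⟨v, hv⟩, dist_comm]
      exact (dist_coe_le_dist _).trans_lt hn
    exact hunif.tendstoLocallyUniformlyOn.differentiableOn
      (.of_forall fun n => differentiableOn_ext (e n)) isOpen_ball
  · have h : ∀ v, Filter.Tendsto (fun n => ext (e n) v) .atTop
        (nhds (Function.extend Subtype.val g 0 v)) := fun v => by
      by_cases hv : v ∈ ball (0 : ℂ) 4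
      · simp_rw [ext_apply _ hv]
        rw [Subtype.val_injective.extend_apply g 0 ⟨v, hv⟩]
        exact hpt ⟨v, hv⟩
      · have hne : ¬∃ a : ball (0 : ℂ) 4, a.1 = v := by
          rintro ⟨a, rfl⟩
          exact hv a.2
        simp_rw [ext, Function.extend_apply' _ _ _ hne]
        exact tendsto_const_nhds
    refine tendsto_nhds_unique (h _) ?_
    simp_rw [ext_conj]
    exact (Complex.continuous_conj.tendsto _).comp (h v)

instance : CompleteSpace realHolomorphicDisc :=
  isClosed.completeSpace_coe

theorem exists_coord : ∃ V : realHolomorphicDisc, ∀ v ∈ ball (0 : ℂ) 4, ext V v = v :=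
  exists_ext_eq (F := fun v => v) differentiableOn_id (fun v => rfl) (C := 4) fun v hv => by
    simpa using (mem_ball_zero_iff.1 hv).le

/-- The coordinate function. -/
noncomputable def coord : realHolomorphicDisc := exists_coord.choose

theorem ext_coord {v : ℂ} (hv : v ∈ ball (0 : ℂ) 4) : ext coord v = v :=
  exists_coord.choose_spec v hv

theorem one_mem : (1 : ℂ) ∈ ball (0 : ℂ) 4 := by simp

/-- An element vanishing at `1` is divisible by `coord - 1`. -/
theorem exists_mul_eq_of_ext_one_eq_zero (f : realHolomorphicDisc) (hf : ext f 1 = 0) :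
    ∃ g, (coord - 1) * g = f := by
  set D := dslope (ext f) 1 with hD
  have hdiff : DifferentiableOn ℂ D (ball 0 4) :=
    (Complex.differentiableOn_dslope (isOpen_ball.mem_nhds one_mem)).2 (differentiableOn_ext f)
  have hconj : ∀ v, D ((starRingEnd ℂ) v) = (starRingEnd ℂ) (D v) := fun v => by
    by_cases hv : v = 1
    · have h : ext f = (starRingEnd ℂ) ∘ ext f ∘ (starRingEnd ℂ) := by
        funext v
        simp [ext_conj]
      have h2 := congrFun (deriv_conj_conj (f := ext f)) 1
      rw [← h] at h2
      simpa [hv, hD] using h2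
    · have hv' : (starRingEnd ℂ) v ≠ 1 := fun h => hv (by simpa using congrArg (starRingEnd ℂ) h)
      rw [hD, dslope_of_ne _ hv, dslope_of_ne _ hv']
      simp [slope, ext_conj, hf]
  obtain ⟨C, hC⟩ := (isCompact_closedBall (1 : ℂ) 1).exists_bound_of_continuousOn
    (hdiff.continuousOn.mono fun v hv => by
      rw [mem_closedBall, dist_eq_norm] at hv
      have := norm_add_le (v - 1) 1
      rw [sub_add_cancel, norm_one] at this
      rw [mem_ball_zero_iff]
      linarith)
  have hbound : ∀ v ∈ ball (0 : ℂ) 4, ‖D v‖ ≤ max C ‖f‖ := fun v hv => by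
    by_cases h1 : v ∈ closedBall (1 : ℂ) 1
    · exact (hC v h1).trans (le_max_left _ _)
    · rw [mem_closedBall, dist_eq_norm, not_le] at h1
      have hv1 : v ≠ 1 := by
        rintro rfl
        simp at h1
        linarith
      rw [hD, dslope_of_ne _ hv1]
      refine le_trans ?_ (le_max_right _ _)
      rw [slope, vsub_eq_sub, hf, sub_zero, norm_smul, norm_inv]
      exact (mul_le_of_le_one_left (norm_nonneg _) (inv_le_one_of_one_le₀ h1.le)).trans
        (norm_ext_le f hv)
  obtain ⟨g, hg⟩ := exists_ext_eq hdiff hconj hbound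
  refine ⟨g, eq_of_ext fun v hv => ?_⟩
  rw [ext_mul _ _ hv, ext_sub _ _ hv, ext_coord hv, ext_one hv, hg v hv]
  simpa [hf] using sub_smul_dslope (ext f) 1 v

theorem eq_zero_of_mul_eq_zero {g : realHolomorphicDisc} (hg : (coord - 1) * g = 0) : g = 0 := by
  have h : ∀ v ∈ ball (0 : ℂ) 4, v ≠ 1 → ext g v = 0 := fun v hv hv1 => by
    have h2 := ext_mul (coord - 1) g hv
    rw [hg, ext_zero hv, ext_sub _ _ hv, ext_coord hv, ext_one hv] at h2
    exact (mul_eq_zero.1 h2.symm).resolve_left (sub_ne_zero.2 hv1)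
  have h1 : ext g 1 = 0 := by
    have hc : ContinuousAt (ext g) 1 :=
      (differentiableOn_ext g).continuousOn.continuousAt (isOpen_ball.mem_nhds one_mem)
    refine tendsto_nhds_unique (hc.tendsto.mono_left nhdsWithin_le_nhds :
      Filter.Tendsto _ (nhdsWithin (1 : ℂ) {1}ᶜ) _) (tendsto_const_nhds.congr' ?_)
    filter_upwards [nhdsWithin_le_nhds (isOpen_ball.mem_nhds one_mem), self_mem_nhdsWithin]
      with v hv hv1 using (h v hv hv1).symm
  refine eq_of_ext fun v hv => ?_
  rw [ext_zero hv]
  by_cases hv1 : v = 1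
  · rw [hv1, h1]
  · exact h v hv hv1

theorem eq_zero_of_linearization_eq_zero (μ : ℝ) (ψ : realHolomorphicDisc)
    (h : (coord - 1) * ψ - μ • (coord + 1) = 0) : μ = 0 ∧ ψ = 0 := by
  have h1 := congrArg (fun f => ext f 1) h
  simp only [ext_sub _ _ one_mem, ext_mul _ _ one_mem, ext_smul _ _ one_mem,
    ext_add _ _ one_mem, ext_coord one_mem, ext_one one_mem, ext_zero one_mem] at h1
  have hμ : μ = 0 := by
    have h2 : (μ : ℂ) = 0 := by linear_combination (-1 / 2) * h1
    exact_mod_cast h2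
  subst hμ
  rw [zero_smul, sub_zero] at h
  exact ⟨rfl, eq_zero_of_mul_eq_zero h⟩

theorem exists_linearization_eq (f : realHolomorphicDisc) :
    ∃ (μ : ℝ) (ψ : realHolomorphicDisc), (coord - 1) * ψ - μ • (coord + 1) = f := by
  have hre : ((ext f 1).re : ℂ) = ext f 1 :=
    Complex.conj_eq_iff_re.1 (by rw [← ext_conj, map_one])
  obtain ⟨g, hg⟩ := exists_mul_eq_of_ext_one_eq_zero
    (f + (-(ext f 1).re / 2) • (coord + 1)) (by
      simp only [ext_smul _ _ one_mem, ext_add _ _ one_mem, ext_coord one_mem, ext_one one_mem]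
      push_cast
      rw [hre]
      ring)
  exact ⟨-(ext f 1).re / 2, g, by rw [hg, add_sub_cancel_right]⟩

theorem ext_uniformizedEquation {m : ℕ} (ε : ℕ → ℝ) (lam : ℝ) (Ψ : realHolomorphicDisc) {v : ℂ}
    (hv : v ∈ ball (0 : ℂ) 4) :
    ext (uniformizedEquation coord m (fun k => ε k, (lam, Ψ))) v
      = v * ext Ψ v ^ 2 + 1 + ∑ k ∈ Finset.Icc 2 m, ε k * (v ^ k * ext Ψ v ^ (2 * k))
        - lam * ((v + 1) * ext Ψ v) := by
  simp only [uniformizedEquation, ext_sub _ _ hv, ext_add _ _ hv, ext_mul _ _ hv, ext_pow _ _ hv,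
    ext_smul _ _ hv, ext_sum _ _ hv, ext_one hv, ext_coord hv]
  rw [← Finset.sum_coe_sort (Finset.Icc 2 m)]

end realHolomorphicDisc

open realHolomorphicDisc in
/-- For small coefficients `ε`, the equation
`v F² + 1 + Σ ε_k v^k F^{2k} = lam (v + 1) F` has a solution `(lam, F)` close to `(1, 1)` with `F`
holomorphic on the disc of radius `4` and commuting with conjugation. -/
theorem exists_holomorphic_solution (m : ℕ) : ∃ C t₀ : ℝ, 0 < C ∧ 0 < t₀ ∧
    ∀ t ≤ t₀, ∀ ε : ℕ → ℝ, (∀ k ∈ Finset.Icc 2 m, |ε k| ≤ t) → 0 ≤ t →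
      ∃ (lam : ℝ) (F : ℂ → ℂ), |lam - 1| ≤ C * t ∧ DifferentiableOn ℂ F (ball 0 4) ∧
        (∀ v, F ((starRingEnd ℂ) v) = (starRingEnd ℂ) (F v)) ∧
        (∀ v ∈ ball (0 : ℂ) 4, ‖F v - 1‖ ≤ C * t) ∧
        ∀ v ∈ ball (0 : ℂ) 4,
          v * F v ^ 2 + 1 + ∑ k ∈ Finset.Icc 2 m, ε k * (v ^ k * F v ^ (2 * k))
            = lam * ((v + 1) * F v) := by
  obtain ⟨C, hC⟩ := exists_uniformizedEquation_eq_zero coord m eq_zero_of_linearization_eq_zero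
    exists_linearization_eq
  obtain ⟨r, hr, hball⟩ := Metric.eventually_nhds_iff_ball.1 hC
  refine ⟨|C| + 1, r / 2, by positivity, by positivity, fun t ht ε hε ht0 => ?_⟩
  have hnorm : ‖fun k : Finset.Icc 2 m => ε k‖ ≤ t :=
    (pi_norm_le_iff_of_nonneg ht0).2 fun k => hε k k.2
  have hle : C * ‖fun k : Finset.Icc 2 m => ε k‖ ≤ (|C| + 1) * t :=
    mul_le_mul ((le_abs_self C).trans (by linarith)) hnorm (norm_nonneg _) (by positivity)
  obtain ⟨lam, Ψ, h0, h1, h2⟩ := hball (fun k => ε k) (by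
    rw [mem_ball_zero_iff]
    linarith)
  refine ⟨lam, ext Ψ, h1.trans hle, differentiableOn_ext Ψ, ext_conj Ψ, fun v hv => ?_,
    fun v hv => ?_⟩
  · have := norm_ext_le (Ψ - 1) hv
    rw [ext_sub _ _ hv, ext_one hv] at this
    exact this.trans (h2.trans hle)
  · have := ext_uniformizedEquation ε lam Ψ (m := m) hv
    rw [h0, ext_zero hv] at this
    exact (sub_eq_zero.1 this.symm)

end RealHolomorphicDisc

open Metric Complex in
/-- If `F` is close to `1` and commutes with conjugation, then `u * F (u²)` maps the upper half of
the unit disc to the upper half-plane. -/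
theorem half_im_sq_le_im_mul_im {F : ℂ → ℂ} (hF : DifferentiableOn ℂ F (ball 0 4))
    (hconj : ∀ v, F ((starRingEnd ℂ) v) = (starRingEnd ℂ) (F v))
    (hbound : ∀ v ∈ ball (0 : ℂ) 4, ‖F v - 1‖ ≤ 1 / 8) {u : ℂ} (hu : ‖u‖ ≤ 1) :
    u.im ^ 2 / 2 ≤ (u * F (u ^ 2)).im * u.im := by
  set G : ℂ → ℂ := fun u => u * (F (u ^ 2) - 1) with hG
  have hsq : Set.MapsTo (fun u : ℂ => u ^ 2) (ball 0 2) (ball 0 4) := fun w hw => by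
    rw [mem_ball_zero_iff] at hw ⊢
    rw [norm_pow]
    nlinarith [norm_nonneg w]
  have hGd : DifferentiableOn ℂ G (ball 0 2) :=
    differentiableOn_id.mul ((hF.comp (by fun_prop) hsq).sub_const 1)
  have hGb : ∀ w ∈ ball (0 : ℂ) 2, ‖G w‖ ≤ 1 / 4 := fun w hw => by
    have h1 := hbound _ (hsq hw)
    rw [mem_ball_zero_iff] at hw
    rw [hG, norm_mul]
    calc ‖w‖ * ‖F (w ^ 2) - 1‖ ≤ 2 * (1 / 8) := by gcongr
      _ = 1 / 4 := by norm_num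
  have hsub : ∀ w ∈ closedBall (0 : ℂ) 1, closedBall w (1 / 2) ⊆ ball 0 2 := fun w hw =>
    (closedBall_subset_ball' (by
      rw [mem_closedBall] at hw
      linarith))
  have hderiv : ∀ w ∈ closedBall (0 : ℂ) 1, ‖deriv G w‖ ≤ 1 / 2 := fun w hw => by
    have := norm_deriv_le_of_forall_mem_sphere_norm_le (by norm_num : (0 : ℝ) < 1 / 2)
      (hGd.diffContOnCl_ball (hsub w hw)) fun z hz =>
        hGb z (hsub w hw (sphere_subset_closedBall hz))
    norm_num at this ⊢
    exact this
  have hat : ∀ w ∈ closedBall (0 : ℂ) 1, DifferentiableAt ℂ G w := fun w hw =>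
    hGd.differentiableAt (isOpen_ball.mem_nhds (closedBall_subset_ball (by norm_num) hw))
  have hmv := (convex_closedBall (0 : ℂ) 1).norm_image_sub_le_of_norm_deriv_le hat hderiv
    (x := (starRingEnd ℂ) u) (y := u) (by simpa using hu) (by simpa using hu)
  have hGc : G ((starRingEnd ℂ) u) = (starRingEnd ℂ) (G u) := by
    simp only [hG, map_mul, map_sub, map_one, ← map_pow, hconj]
  rw [hGc, sub_conj, sub_conj, norm_mul, norm_mul, norm_I, norm_real, norm_real, mul_one, mul_one,
    Real.norm_eq_abs, Real.norm_eq_abs, abs_mul, abs_mul, abs_two] at hmv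
  have h2 : (u * F (u ^ 2)).im = u.im + (G u).im := by
    simp only [hG, mul_sub, mul_one, sub_im]
    ring
  have h3 : |(G u).im * u.im| ≤ u.im ^ 2 / 2 := by
    rw [abs_mul, ← sq_abs u.im]
    nlinarith [abs_nonneg u.im]
  rw [h2]
  linarith [neg_abs_le ((G u).im * u.im)]

/-- The Joukowski map `u ↦ -lam (u + 1 / u)` from the upper half of the unit disc covers the upper
half-plane. -/
theorem exists_joukowski_preimage {lam : ℝ} (hlam : 0 < lam) {z : ℂ} (hz : 0 < z.im) :
    ∃ u : ℂ, ‖u‖ < 1 ∧ 0 < u.im ∧ z = -lam * (u + u⁻¹) := by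
  have hlamC : (lam : ℂ) ≠ 0 := by exact_mod_cast hlam.ne'
  have hroot : ∃ u : ℂ, u ≠ 0 ∧ z = -lam * (u + u⁻¹) := by
    obtain ⟨s, hs⟩ := IsAlgClosed.exists_pow_nat_eq ((z / lam) ^ 2 - 4) two_pos
    have hu : ((-(z / lam) + s) / 2) ^ 2 + z / lam * ((-(z / lam) + s) / 2) + 1 = 0 := by
      linear_combination hs / 4
    set u := (-(z / lam) + s) / 2
    have hu0 : u ≠ 0 := fun h => by simp [h] at hu
    refine ⟨u, hu0, ?_⟩
    field_simp at hu ⊢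
    linear_combination hu
  have hball : ∃ u : ℂ, u ≠ 0 ∧ ‖u‖ ≤ 1 ∧ z = -lam * (u + u⁻¹) := by
    obtain ⟨u, hu0, hu⟩ := hroot
    rcases le_total ‖u‖ 1 with h | h
    · exact ⟨u, hu0, h, hu⟩
    · exact ⟨u⁻¹, inv_ne_zero hu0, by rw [norm_inv]; exact inv_le_one_of_one_le₀ h,
        by rw [inv_inv, add_comm, hu]⟩
  obtain ⟨u, hu0, hu1, hu⟩ := hball
  have hn : 0 < ‖u‖ ^ 2 := by positivity
  have him : z.im * ‖u‖ ^ 2 = lam * (u.im * (1 - ‖u‖ ^ 2)) := by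
    have : z.im = -lam * (u.im - u.im / ‖u‖ ^ 2) := by
      rw [hu, ← Complex.normSq_eq_norm_sq, ← Complex.ofReal_neg, Complex.im_ofReal_mul,
        Complex.add_im, Complex.inv_im]
      ring
    rw [this]
    field_simp
    ring
  have hprod : 0 < u.im * (1 - ‖u‖ ^ 2) :=
    pos_of_mul_pos_right (him ▸ mul_pos hz hn) hlam.le
  have hle : 0 ≤ 1 - ‖u‖ ^ 2 := by nlinarith [norm_nonneg u]
  refine ⟨u, hu1.lt_of_ne fun h => ?_, pos_of_mul_pos_left hprod hle, hu⟩
  simp [h] at hprod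

open ENNReal in
/-- The symmetrization of a measure on `ℝ`. -/
noncomputable def symmetrization (μ : Measure ℝ) : Measure ℝ :=
  (2⁻¹ : ℝ≥0∞) • (μ + μ.map fun x => -x)

theorem isProbabilityMeasure_symmetrization (μ : Measure ℝ) [IsProbabilityMeasure μ] :
    IsProbabilityMeasure (symmetrization μ) := by
  refine ⟨?_⟩
  have : IsProbabilityMeasure (μ.map fun x => -x) :=
    Measure.isProbabilityMeasure_map measurable_neg.aemeasurable
  rw [symmetrization, Measure.smul_apply, Measure.add_apply, measure_univ, measure_univ,
    smul_eq_mul, one_add_one_eq_two, ENNReal.inv_mul_cancel two_ne_zero ENNReal.ofNat_ne_top]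

theorem map_neg_symmetrization (μ : Measure ℝ) :
    (symmetrization μ).map (fun x => -x) = symmetrization μ := by
  rw [symmetrization, Measure.map_smul, Measure.map_add _ _ measurable_neg,
    Measure.map_map measurable_neg measurable_neg, add_comm (μ.map _)]
  congr 2
  convert Measure.map_id
  funext x
  simp

theorem symmetrization_compl_Icc {μ : Measure ℝ} {L : ℝ} (h : μ (Set.Icc (-L) L)ᶜ = 0) :
    symmetrization μ (Set.Icc (-L) L)ᶜ = 0 := by
  have hpre : (fun x : ℝ => -x) ⁻¹' (Set.Icc (-L) L)ᶜ = (Set.Icc (-L) L)ᶜ := by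
    ext x
    simp only [Set.mem_preimage, Set.mem_compl_iff, Set.mem_Icc, neg_le_neg_iff, neg_le, and_comm]
  rw [symmetrization, Measure.smul_apply, Measure.add_apply,
    Measure.map_apply measurable_neg measurableSet_Icc.compl, hpre, h, add_zero, smul_zero]

theorem stieltjesTransform_map_neg (μ : Measure ℝ) (z : ℂ) :
    stieltjesTransform (μ.map fun x => -x) z = -stieltjesTransform μ (-z) := by
  rw [stieltjesTransform, stieltjesTransform, integral_map measurable_neg.aemeasurable
    (Measurable.aestronglyMeasurable (by fun_prop)), ← integral_neg]
  refine integral_congr_ae (.of_forall fun x => ?_)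
  simp only
  rw [← inv_neg]
  congr 1
  push_cast
  ring

theorem integrable_inv_sub (μ : Measure ℝ) [IsFiniteMeasure μ] {z : ℂ} (hz : 0 < z.im) :
    Integrable (fun x : ℝ => ((x : ℂ) - z)⁻¹) μ := by
  refine .of_bound (Measurable.aestronglyMeasurable (by fun_prop)) z.im⁻¹ (.of_forall fun x => ?_)
  rw [norm_inv]
  gcongr
  simpa [abs_of_pos hz] using Complex.abs_im_le_norm ((x : ℂ) - z)

theorem stieltjesTransform_symmetrization (μ : Measure ℝ) [IsFiniteMeasure μ] {z : ℂ}
    (hz : 0 < z.im) :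
    stieltjesTransform (symmetrization μ) z
      = (stieltjesTransform μ z - stieltjesTransform μ (-z)) / 2 := by
  have h := stieltjesTransform_map_neg μ z
  rw [stieltjesTransform] at h ⊢
  rw [symmetrization, integral_smul_measure, integral_add_measure (integrable_inv_sub _ hz)
    (integrable_inv_sub _ hz), h, ← sub_eq_add_neg, ← stieltjesTransform, Complex.real_smul]
  simp
  ring

open Metric in
/-- The symmetrized arc measure of `u ↦ u * F (u²)` has Stieltjes transform `u * F (u²)` at
`-lam * (u + 1 / u)`. -/
theorem symmetrization_arcMeasure_properties {lam : ℝ} {F : ℂ → ℂ} (hlam : 0 < lam)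
    (hF : DifferentiableOn ℂ F (ball 0 4))
    (hconj : ∀ v, F ((starRingEnd ℂ) v) = (starRingEnd ℂ) (F v))
    (hbound : ∀ v ∈ ball (0 : ℂ) 4, ‖F v - 1‖ ≤ 1 / 8) (hmass : lam * F 0 = 1) :
    IsProbabilityMeasure (symmetrization (arcMeasure lam fun u => u * F (u ^ 2))) ∧
      ∀ z : ℂ, 0 < z.im → ∃ u : ℂ, ‖u‖ < 1 ∧ u ≠ 0 ∧ z = -lam * (u + u⁻¹) ∧
        0 < (u * F (u ^ 2)).im ∧
        stieltjesTransform (symmetrization (arcMeasure lam fun u => u * F (u ^ 2))) z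
          = u * F (u ^ 2) := by
  have hsq : Set.MapsTo (fun u : ℂ => u ^ 2) (ball 0 2) (ball 0 4) := fun w hw => by
    rw [mem_ball_zero_iff] at hw ⊢
    rw [norm_pow]
    nlinarith [norm_nonneg w]
  have hg : DiffContOnCl ℂ (fun u => F (u ^ 2)) (ball 0 1) :=
    (hF.comp (by fun_prop) hsq).diffContOnCl_ball (closedBall_subset_ball one_lt_two)
  have hgconj : ∀ u ∈ sphere (0 : ℂ) 1, F (u⁻¹ ^ 2) = (starRingEnd ℂ) (F (u ^ 2)) :=
    fun u hu => by
      rw [Complex.inv_eq_conj (by simpa using hu), ← map_pow, hconj]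
  have hpos : ∀ u ∈ sphere (0 : ℂ) 1, 0 ≤ (u * F (u ^ 2)).im * u.im := fun u hu =>
    le_trans (by positivity)
      (half_im_sq_le_im_mul_im hF hconj hbound (mem_sphere_zero_iff_norm.1 hu).le)
  have hprob : IsProbabilityMeasure (arcMeasure lam fun u => u * F (u ^ 2)) :=
    isProbabilityMeasure_arcMeasure hlam.le hg hgconj hpos (by simpa using hmass)
  refine ⟨isProbabilityMeasure_symmetrization _, fun z hz => ?_⟩
  obtain ⟨u, hu1, hu, hzu⟩ := exists_joukowski_preimage hlam hz
  have hu0 : u ≠ 0 := by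
    rintro rfl
    simp at hu
  refine ⟨u, hu1, hu0, hzu, ?_, ?_⟩
  · have := half_im_sq_le_im_mul_im hF hconj hbound hu1.le
    exact pos_of_mul_pos_left (lt_of_lt_of_le (by positivity) this) hu.le
  · have h1 := stieltjesTransform_arcMeasure hlam hg hgconj hpos hu1 hu0
    have h2 := stieltjesTransform_arcMeasure hlam hg hgconj hpos (w := -u) (by simpa using hu1)
      (neg_ne_zero.2 hu0)
    have h3 : -z = -lam * (-u + (-u)⁻¹) := by
      rw [hzu, inv_neg]
      ring
    rw [stieltjesTransform_symmetrization _ hz, h3, h2, hzu, h1, neg_sq]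
    ring

theorem P₀_eq_zero_of_uniformized {q : ℝ} {a : ℕ → ℝ} {m : ℕ} {lam : ℝ} {u f : ℂ} (hu : u ≠ 0)
    (h : u ^ 2 * f ^ 2 + 1 + ∑ k ∈ Finset.Icc 2 m,
        ((a k / q ^ (2 * (k - 1)) : ℝ) : ℂ) * ((u ^ 2) ^ k * f ^ (2 * k))
      = lam * ((u ^ 2 + 1) * f)) :
    P₀ q a m (-lam * (u + u⁻¹)) (u * f) = 0 := by
  have hsum : ∑ k ∈ Finset.Icc 2 m, ((a k : ℂ) / (q : ℂ) ^ (2 * (k - 1))) * (u * f) ^ (2 * k)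
      = ∑ k ∈ Finset.Icc 2 m,
        ((a k / q ^ (2 * (k - 1)) : ℝ) : ℂ) * ((u ^ 2) ^ k * f ^ (2 * k)) :=
    Finset.sum_congr rfl fun k _ => by
      push_cast
      rw [mul_pow, pow_mul u]
  have hz : -lam * (u + u⁻¹) * (u * f) = -(lam * ((u ^ 2 + 1) * f)) := by
    field_simp
  rw [P₀, hsum, hz]
  linear_combination h

/-- **Deterministic self-consistent root near the semicircle**: for the polynomial
`P₀(z,x) = 1 + zx + x² + Σ_{k=2}^m a_k q^{−2(k−1)} x^{2k}` with bounded real coefficients and `q`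
large, there is a function `m₀ : ℂ₊ → ℂ₊` with `P₀(z, m₀(z)) = 0` which is the Stieltjes transform
of a symmetric probability measure `ϱ₀` supported on `[−L₀, L₀]` with `L₀ = 2 + O(1/q²)`. -/
theorem self_consistent_root_exists (A : ℝ) (hA : 0 < A) (m : ℕ) (hm : 2 ≤ m) :
    ∃ C q₀ : ℝ, 0 < C ∧ 0 < q₀ ∧
      ∀ q : ℝ, q₀ ≤ q → ∀ a : ℕ → ℝ, (∀ k, |a k| ≤ A) →
        ∃ (ϱ₀ : Measure ℝ) (L₀ : ℝ),
          IsProbabilityMeasure ϱ₀ ∧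
          ϱ₀.map (fun x => -x) = ϱ₀ ∧
          ϱ₀ (Set.Icc (-L₀) L₀)ᶜ = 0 ∧
          |L₀ - 2| ≤ C / q ^ 2 ∧
          ∀ z : ℂ, 0 < z.im →
            0 < (stieltjesTransform ϱ₀ z).im ∧
            P₀ q a m z (stieltjesTransform ϱ₀ z) = 0 := by
  obtain ⟨C, t₀, hC, ht₀, H⟩ := exists_holomorphic_solution m
  have hs : 0 < min t₀ (1 / (8 * C)) := by positivity
  refine ⟨2 * C * A, max 1 (√(A / min t₀ (1 / (8 * C)))), by positivity, by positivity,
    fun q hq a ha => ?_⟩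
  have hq1 : 1 ≤ q := (le_max_left _ _).trans hq
  have hq2 : A / min t₀ (1 / (8 * C)) ≤ q ^ 2 :=
    (Real.sqrt_le_left (by positivity)).1 ((le_max_right _ _).trans hq)
  have ht : A / q ^ 2 ≤ min t₀ (1 / (8 * C)) := by
    rw [div_le_iff₀ hs] at hq2
    rw [div_le_iff₀ (by positivity)]
    linarith
  have hCt : C * (A / q ^ 2) ≤ 1 / 8 := by
    calc C * (A / q ^ 2) ≤ C * (1 / (8 * C)) :=
          mul_le_mul_of_nonneg_left (ht.trans (min_le_right _ _)) hC.le
      _ = 1 / 8 := by field_simp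
  obtain ⟨lam, F, hlam, hF, hconj, hbound, heq⟩ := H (A / q ^ 2) (ht.trans (min_le_left _ _))
    (fun k => a k / q ^ (2 * (k - 1))) (fun k hk => by
      have hk2 := (Finset.mem_Icc.1 hk).1
      rw [abs_div, abs_of_nonneg (by positivity : 0 ≤ q ^ (2 * (k - 1)))]
      exact div_le_div₀ hA.le (ha k) (by positivity) (pow_le_pow_right₀ hq1 (by omega)))
    (by positivity)
  have hlam0 : 0 < lam := by linarith [(abs_le.1 (hlam.trans hCt)).1]
  have hmass : lam * F 0 = 1 := by
    have h0 : ∑ k ∈ Finset.Icc 2 m, ((a k / q ^ (2 * (k - 1)) : ℝ) : ℂ) *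
        ((0 : ℂ) ^ k * F 0 ^ (2 * k)) = 0 :=
      Finset.sum_eq_zero fun k hk => by
        have hk2 := (Finset.mem_Icc.1 hk).1
        rw [zero_pow (by omega), zero_mul, mul_zero]
    have h := heq 0 (by simp)
    rw [h0] at h
    linear_combination -h
  obtain ⟨hprob, hst⟩ := symmetrization_arcMeasure_properties hlam0 hF hconj
    (fun v hv => (hbound v hv).trans hCt) hmass
  refine ⟨_, 2 * lam, hprob, map_neg_symmetrization _,
    symmetrization_compl_Icc (arcMeasure_compl_Icc hlam0.le _), ?_, fun z hz => ?_⟩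
  · calc |2 * lam - 2| = 2 * |lam - 1| := by rw [← mul_sub_one, abs_mul, abs_two]
      _ ≤ 2 * (C * (A / q ^ 2)) := by gcongr
      _ = 2 * C * A / q ^ 2 := by ring
  · obtain ⟨u, hu1, hu0, hzu, him, hS⟩ := hst z hz
    refine ⟨hS ▸ him, ?_⟩
    rw [hS, hzu]
    refine P₀_eq_zero_of_uniformized hu0 (heq _ ?_)
    rw [Metric.mem_ball, dist_zero_right, norm_pow]
    nlinarith [norm_nonneg u]
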